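/- Let N = 2I range over even integers tending to infinity with class sizes N_s(N) (each assumed even and positive) satisfying N_s(N)/N → p_s ∈ (0,1), Σ_s p_s = 1. For each N, let Ā_N := (a_{st})_{1≤s<t≤K} ∈ ℝ^{m}, m = K(K−1)/2, be the cross-count vector under a uniformly random labeling, with mean vector E[Ā_N] and covariance matrix Σ_N := Cov(Ā_N) (which is invertible since every N_s(N) is even). Then the standardized vector Σ_N^{−1/2}(Ā_N − E[Ā_N]) converges in distribution, as N → ∞, to the m-dimensional Gaussian distribution with mean 0 and identity covariance matrix. -/

import Mathlib

open Finset Filter MeasureTheory ProbabilityTheory Topology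

namespace Crossmatch

/-- First endpoint (index `2j`, i.e., the paper's `2j-1` in 1-based indexing) of the `j`-th
matched pair in the fixed perfect matching on `{1, …, 2I}`. -/
def ep1 {I : ℕ} (j : Fin I) : Fin (2 * I) := ⟨2 * j.val, by have := j.isLt; omega⟩

/-- Second endpoint (index `2j+1`, i.e., the paper's `2j`) of the `j`-th matched pair. -/
def ep2 {I : ℕ} (j : Fin I) : Fin (2 * I) := ⟨2 * j.val + 1, by have := j.isLt; omega⟩

/-- The set of labelings `L : {1,…,2I} → {1,…,K}` assigning label `s` to exactly `Nc s`
indices, for every `s`. -/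
def labelings (I K : ℕ) (Nc : Fin K → ℕ) : Finset (Fin (2 * I) → Fin K) :=
  univ.filter fun L => ∀ s : Fin K, (univ.filter fun i => L i = s).card = Nc s

/-- The count `a_{st}(L)`: the number of matched pairs `j` with `{L(2j-1), L(2j)} = {s,t}`.
For `s ≠ t` this is the cross-count; for `s = t` it is the pure count (both endpoints labeled
`s`). -/
def crossCount (I K : ℕ) (L : Fin (2 * I) → Fin K) (s t : Fin K) : ℕ :=
  (univ.filter fun j : Fin I =>
    ({L (ep1 j), L (ep2 j)} : Finset (Fin K)) = ({s, t} : Finset (Fin K))).card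

/-- Expectation of a real-valued statistic under a uniformly random labeling. -/
noncomputable def expct (I K : ℕ) (Nc : Fin K → ℕ)
    (X : (Fin (2 * I) → Fin K) → ℝ) : ℝ :=
  (∑ L ∈ labelings I K Nc, X L) / ((labelings I K Nc).card : ℝ)

open Classical in
/-- Probability of an event under a uniformly random labeling. -/
noncomputable def pr (I K : ℕ) (Nc : Fin K → ℕ)
    (ev : (Fin (2 * I) → Fin K) → Prop) : ℝ :=
  (((labelings I K Nc).filter ev).card : ℝ) / ((labelings I K Nc).card : ℝ)

/-- Variance of a real-valued statistic under a uniformly random labeling. -/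
noncomputable def variance (I K : ℕ) (Nc : Fin K → ℕ)
    (X : (Fin (2 * I) → Fin K) → ℝ) : ℝ :=
  expct I K Nc (fun L => (X L - expct I K Nc X) ^ 2)

/-- Covariance of two real-valued statistics under a uniformly random labeling. -/
noncomputable def covar (I K : ℕ) (Nc : Fin K → ℕ)
    (X Y : (Fin (2 * I) → Fin K) → ℝ) : ℝ :=
  expct I K Nc (fun L => (X L - expct I K Nc X) * (Y L - expct I K Nc Y))

/-- The index set of (unordered) pairs `s < t`, indexing the cross-count vector. -/
abbrev Pairs (K : ℕ) := {q : Fin K × Fin K // q.1 < q.2}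

/-- The covariance matrix of the cross-count vector `(a_{st})_{s<t}` under a uniformly
random labeling. -/
noncomputable def covMatrix (I K : ℕ) (Nc : Fin K → ℕ) :
    Matrix (Pairs K) (Pairs K) ℝ :=
  Matrix.of fun q r =>
    covar I K Nc (fun L => (crossCount I K L q.1.1 q.1.2 : ℝ))
      (fun L => (crossCount I K L r.1.1 r.1.2 : ℝ))


set_option linter.unusedSectionVars false

section Abstract

variable {V κ : Type*} [Fintype V] [DecidableEq V] [Fintype κ] [DecidableEq κ]

/-- pair statistic, summed over all vertices -/
def pst (m : V → V) (g : κ → κ → ℝ) (L : V → κ) : ℝ := ∑ i, g (L i) (L (m i))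

/-- unrestricted increment formula -/
def inc0 (m : V → V) (g : κ → κ → ℝ) (L : V → κ) (i k : V) : ℝ :=
  2 * (g (L k) (L (m i)) + g (L i) (L (m k)) - g (L i) (L (m i)) - g (L k) (L (m k)))

/-- increment under a swap -/
def inc (m : V → V) (g : κ → κ → ℝ) (L : V → κ) (i k : V) : ℝ :=
  pst m g (L ∘ Equiv.swap i k) - pst m g L

theorem sum_comp_invol (m : V → V) (hm : ∀ i, m (m i) = i) {M : Type*} [AddCommMonoid M]
    (F : V → M) : ∑ i, F (m i) = ∑ i, F i :=
  Equiv.sum_comp (⟨m, m, hm, hm⟩ : V ≃ V) F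

theorem inc_partner (m : V → V) (hm : ∀ i, m (m i) = i) (g : κ → κ → ℝ)
    (hg : ∀ s t, g s t = g t s) (L : V → κ) (i : V) : inc m g L i (m i) = 0 := by
  unfold inc pst
  rw [← Finset.sum_sub_distrib]
  refine Finset.sum_eq_zero fun v _ => ?_
  simp only [Function.comp]
  have inj : ∀ a b, m a = m b → a = b := fun a b h => by rw [← hm a, h, hm]
  by_cases h1 : v = i
  · subst h1
    rw [Equiv.swap_apply_left, Equiv.swap_apply_right, hg]; simp
  · by_cases h2 : v = m i
    · subst h2
      rw [Equiv.swap_apply_right, hm, Equiv.swap_apply_left, hg]; simp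
    · rw [Equiv.swap_apply_of_ne_of_ne h1 h2, Equiv.swap_apply_of_ne_of_ne, sub_self]
      · intro h; apply h2; rw [← h, hm]
      · intro h; exact h1 (inj _ _ h)

theorem inc_eq (m : V → V) (hm : ∀ i, m (m i) = i) (hf : ∀ i, m i ≠ i) (g : κ → κ → ℝ)
    (hg : ∀ s t, g s t = g t s) (L : V → κ) (i k : V) (hk : k ≠ m i) :
    inc m g L i k = inc0 m g L i k := by
  by_cases hik : k = i
  · subst hik
    simp [inc, inc0]
  have inj : ∀ a b, m a = m b → a = b := fun a b h => by rw [← hm a, h, hm]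
  have hk' : i ≠ m k := fun h => hk (by rw [h, hm])
  unfold inc pst inc0
  rw [← Finset.sum_sub_distrib, ← Finset.sum_subset (Finset.subset_univ {i, k, m i, m k})]
  · have e1 : m i ≠ k := fun h => hk h.symm
    have e2 : m k ≠ i := fun h => hk' h.symm
    have e3 : m i ≠ m k := fun h => hik (inj _ _ h).symm
    have e4 := hf i
    have e5 := hf k
    rw [Finset.sum_insert, Finset.sum_insert, Finset.sum_insert, Finset.sum_singleton]
    · simp only [Function.comp, hm, Equiv.swap_apply_left, Equiv.swap_apply_right]
      rw [Equiv.swap_apply_of_ne_of_ne e4 e1, Equiv.swap_apply_of_ne_of_ne e2 e5,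
        hg (L (m i)) (L k), hg (L (m k)) (L i), hg (L (m i)) (L i), hg (L (m k)) (L k)]
      ring
    · simpa using e3
    · simp only [Finset.mem_insert, Finset.mem_singleton]
      push Not
      exact ⟨hk, e5.symm⟩
    · simp only [Finset.mem_insert, Finset.mem_singleton]
      push Not
      exact ⟨fun h => hik h.symm, e4.symm, hk'⟩
  · intro v _ hv
    simp only [Finset.mem_insert, Finset.mem_singleton] at hv
    push Not at hv
    simp only [Function.comp]
    rw [Equiv.swap_apply_of_ne_of_ne hv.1 hv.2.1, Equiv.swap_apply_of_ne_of_ne, sub_self]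
    · intro h; apply hv.2.2.1; rw [← h, hm]
    · intro h; apply hv.2.2.2; rw [← h, hm]

theorem sum_label (Ns : κ → ℕ) (L : V → κ)
    (hL : ∀ s, (univ.filter fun i => L i = s).card = Ns s) (F : κ → ℝ) :
    ∑ i, F (L i) = ∑ s, (Ns s : ℝ) * F s := by
  rw [← Finset.sum_fiberwise univ L]
  refine Finset.sum_congr rfl fun s _ => ?_
  rw [Finset.sum_congr rfl (g := fun _ => F s), Finset.sum_const, hL, nsmul_eq_mul]
  intro i hi
  rw [(Finset.mem_filter.1 hi).2]

/-- `(N-1)` times the mean -/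
def qst (Ns : κ → ℕ) (g : κ → κ → ℝ) : ℝ :=
  (∑ s, (Ns s : ℝ) * ∑ t, (Ns t : ℝ) * g s t) - ∑ s, (Ns s : ℝ) * g s s

theorem sum_inc (m : V → V) (hm : ∀ i, m (m i) = i) (hf : ∀ i, m i ≠ i) (g : κ → κ → ℝ)
    (hg : ∀ s t, g s t = g t s) (Ns : κ → ℕ) (L : V → κ)
    (hL : ∀ s, (univ.filter fun i => L i = s).card = Ns s) :
    ∑ i, ∑ k, inc m g L i k =
      4 * (qst Ns g - ((Fintype.card V : ℝ) - 1) * pst m g L) := by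
  have h1 : ∀ i, ∑ k, inc m g L i k = ∑ k, inc0 m g L i k - inc0 m g L i (m i) := by
    intro i
    rw [← Finset.add_sum_erase univ _ (Finset.mem_univ (m i)),
      ← Finset.add_sum_erase univ (fun k => inc0 m g L i k) (Finset.mem_univ (m i)),
      inc_partner m hm g hg, zero_add, add_sub_cancel_left]
    exact Finset.sum_congr rfl fun k hk => inc_eq m hm hf g hg L i k (Finset.ne_of_mem_erase hk)
  have h2 : ∑ i, ∑ k, g (L k) (L (m i)) = ∑ s, (Ns s : ℝ) * ∑ t, (Ns t : ℝ) * g s t := by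
    rw [sum_comp_invol m hm (fun i => ∑ k, g (L k) (L i)),
      sum_label Ns L hL (fun s => ∑ k, g (L k) s)]
    refine Finset.sum_congr rfl fun s _ => ?_
    rw [sum_label Ns L hL (fun t => g t s)]
    simp_rw [hg _ s]
  have h3 : ∑ i, ∑ k, g (L i) (L (m k)) = ∑ s, (Ns s : ℝ) * ∑ t, (Ns t : ℝ) * g s t := by
    rw [Finset.sum_comm, h2]
  have h4 : ∑ i, g (L (m i)) (L (m i)) = ∑ s, (Ns s : ℝ) * g s s := by
    rw [sum_comp_invol m hm (fun i => g (L i) (L i)), sum_label Ns L hL (fun s => g s s)]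
  have h5 : ∑ i, g (L i) (L i) = ∑ s, (Ns s : ℝ) * g s s := by
    rw [sum_label Ns L hL (fun s => g s s)]
  have h6 : ∑ i, g (L (m i)) (L i) = pst m g L := by
    unfold pst
    exact Finset.sum_congr rfl fun i _ => hg _ _
  simp_rw [h1, inc0, hm]
  simp only [Finset.sum_sub_distrib, ← Finset.mul_sum, Finset.sum_add_distrib, h2, h3, h4, h5, h6,
    Finset.sum_const, Finset.card_univ, nsmul_eq_mul]
  change _ - 2 * (_ + _ - pst m g L - _) = _
  have h7 : ∑ i, g (L i) (L (m i)) = pst m g L := rfl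
  rw [h7]
  unfold qst
  ring

theorem dirichlet (m : V → V) (hm : ∀ i, m (m i) = i) (hf : ∀ i, m i ≠ i) (g : κ → κ → ℝ)
    (hg : ∀ s t, g s t = g t s) (Ns : κ → ℕ) (Om : Finset (V → κ))
    (hL : ∀ L ∈ Om, ∀ s, (univ.filter fun i => L i = s).card = Ns s)
    (hO : ∀ L ∈ Om, ∀ i k, L ∘ Equiv.swap i k ∈ Om) (B : (V → κ) → ℂ) :
    ∑ L ∈ Om, ∑ i, ∑ k, (inc m g L i k : ℂ) * (B (L ∘ Equiv.swap i k) - B L) =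
      8 * ∑ L ∈ Om, ((((Fintype.card V : ℝ) - 1) * pst m g L - qst Ns g : ℝ) : ℂ) * B L := by
  have hss : ∀ (L : V → κ) i k, (L ∘ Equiv.swap i k) ∘ Equiv.swap i k = L := by
    intro L i k; funext v; simp
  have h1 : ∀ i k, ∑ L ∈ Om, (inc m g L i k : ℂ) * B (L ∘ Equiv.swap i k) =
      - ∑ L ∈ Om, (inc m g L i k : ℂ) * B L := by
    intro i k
    rw [← Finset.sum_neg_distrib]
    refine Finset.sum_nbij' (fun L => L ∘ Equiv.swap i k) (fun L => L ∘ Equiv.swap i k)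
      (fun L h => hO L h i k) (fun L h => hO L h i k) (fun L _ => hss L i k)
      (fun L _ => hss L i k) ?_
    intro L _
    unfold inc
    rw [hss]
    push_cast
    ring
  have h2 : ∑ L ∈ Om, ∑ i, ∑ k, (inc m g L i k : ℂ) * (B (L ∘ Equiv.swap i k) - B L) =
      -2 * ∑ L ∈ Om, ∑ i, ∑ k, (inc m g L i k : ℂ) * B L := by
    rw [Finset.sum_comm, Finset.sum_comm (s := Om), Finset.mul_sum]
    refine Finset.sum_congr rfl fun i _ => ?_
    rw [Finset.sum_comm, Finset.sum_comm (s := Om), Finset.mul_sum]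
    refine Finset.sum_congr rfl fun k _ => ?_
    simp_rw [mul_sub]
    rw [Finset.sum_sub_distrib, h1]
    ring
  rw [h2, Finset.mul_sum, Finset.mul_sum]
  refine Finset.sum_congr rfl fun L hLO => ?_
  have h3 := sum_inc m hm hf g hg Ns L (hL L hLO)
  have h4 : ∑ i, ∑ k, (inc m g L i k : ℂ) * B L
      = ((∑ i, ∑ k, inc m g L i k : ℝ) : ℂ) * B L := by
    push_cast
    simp_rw [Finset.sum_mul]
  rw [h4, h3]
  push_cast
  ring

end Abstract

section Abstract2

variable {V κ : Type*} [Fintype V] [DecidableEq V] [Fintype κ] [DecidableEq κ]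

/-- bundle of the assumptions on the labeling space -/
structure Setup (m : V → V) (Ns : κ → ℕ) (Om : Finset (V → κ)) : Prop where
  hm : ∀ i, m (m i) = i
  hf : ∀ i, m i ≠ i
  hL : ∀ L ∈ Om, ∀ s, (univ.filter fun i => L i = s).card = Ns s
  hO : ∀ L ∈ Om, ∀ i k, L ∘ Equiv.swap i k ∈ Om
  ne : Om.Nonempty
  hN : (2 : ℝ) ≤ (Fintype.card V : ℝ)

variable {m : V → V} {Ns : κ → ℕ} {Om : Finset (V → κ)}

/-- mean -/
noncomputable def mst (V : Type*) [Fintype V] (Ns : κ → ℕ) (g : κ → κ → ℝ) : ℝ :=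
  qst Ns g / ((Fintype.card V : ℝ) - 1)

theorem Setup.dir (h : Setup m Ns Om) (g : κ → κ → ℝ) (hg : ∀ s t, g s t = g t s)
    (B : (V → κ) → ℂ) :
    ∑ L ∈ Om, ∑ i, ∑ k, (inc m g L i k : ℂ) * (B (L ∘ Equiv.swap i k) - B L) =
      8 * ((Fintype.card V : ℝ) - 1 : ℝ) *
        ∑ L ∈ Om, ((pst m g L - mst V Ns g : ℝ) : ℂ) * B L := by
  rw [dirichlet m h.hm h.hf g hg Ns Om h.hL h.hO B, mul_assoc]
  congr 1
  rw [Finset.mul_sum]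
  refine Finset.sum_congr rfl fun L _ => ?_
  have : ((Fintype.card V : ℝ) - 1) ≠ 0 := by linarith [h.hN]
  rw [← mul_assoc, ← Complex.ofReal_mul]
  congr 2
  unfold mst
  field_simp

theorem Setup.mean (h : Setup m Ns Om) (g : κ → κ → ℝ) (hg : ∀ s t, g s t = g t s) :
    ∑ L ∈ Om, (pst m g L - mst V Ns g) = 0 := by
  have h1 := h.dir g hg (fun _ => 1)
  have h2 : (((Fintype.card V : ℝ) - 1 : ℝ) : ℂ) ≠ 0 := by
    rw [Complex.ofReal_ne_zero]; linarith [h.hN]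
  simp only [sub_self, mul_zero, Finset.sum_const_zero, mul_one] at h1
  have h3 := (mul_eq_zero.1 h1.symm).resolve_left (mul_ne_zero (by norm_num) h2)
  rw [← Complex.ofReal_sum] at h3
  exact_mod_cast h3

theorem Setup.var (h : Setup m Ns Om) (g : κ → κ → ℝ) (hg : ∀ s t, g s t = g t s) :
    ∑ L ∈ Om, ∑ i, ∑ k, (inc m g L i k) ^ 2 = 8 * ((Fintype.card V : ℝ) - 1) *
      ∑ L ∈ Om, (pst m g L - mst V Ns g) ^ 2 := by
  have h1 := h.dir g hg (fun L => ((pst m g L - mst V Ns g : ℝ) : ℂ))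
  have h2 : ∀ L i k, (((pst m g (L ∘ Equiv.swap i k) - mst V Ns g : ℝ) : ℂ)
      - ((pst m g L - mst V Ns g : ℝ) : ℂ)) = ((inc m g L i k : ℝ) : ℂ) := by
    intro L i k
    unfold inc
    push_cast
    ring
  simp_rw [h2] at h1
  simp_rw [sq]
  exact_mod_cast h1

theorem inc0_abs (m : V → V) (g : κ → κ → ℝ) {G : ℝ} (hG : ∀ s t, |g s t| ≤ G)
    (L : V → κ) (i k : V) : |inc0 m g L i k| ≤ 8 * G := by
  unfold inc0
  have h1 := abs_le.1 (hG (L k) (L (m i)))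
  have h2 := abs_le.1 (hG (L i) (L (m k)))
  have h3 := abs_le.1 (hG (L i) (L (m i)))
  have h4 := abs_le.1 (hG (L k) (L (m k)))
  rw [abs_le]
  constructor <;> linarith

theorem Setup.inc_abs (h : Setup m Ns Om) (g : κ → κ → ℝ) (hg : ∀ s t, g s t = g t s)
    {G : ℝ} (hG0 : 0 ≤ G) (hG : ∀ s t, |g s t| ≤ G)
    (L : V → κ) (i k : V) : |inc m g L i k| ≤ 8 * G := by
  by_cases hk : k = m i
  · rw [hk, inc_partner m h.hm g hg, abs_zero]; positivity
  · rw [inc_eq m h.hm h.hf g hg L i k hk]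
    exact inc0_abs m g hG L i k

theorem Setup.var_le (h : Setup m Ns Om) (g : κ → κ → ℝ) (hg : ∀ s t, g s t = g t s)
    {G : ℝ} (hG0 : 0 ≤ G) (hG : ∀ s t, |g s t| ≤ G) :
    ∑ L ∈ Om, (pst m g L - mst V Ns g) ^ 2 ≤
      (Om.card : ℝ) * (16 * (Fintype.card V : ℝ) * G ^ 2) := by
  have h1 := h.var g hg
  have hN := h.hN
  have h2 : ∑ L ∈ Om, ∑ i, ∑ k, (inc m g L i k) ^ 2 ≤
      (Om.card : ℝ) * ((Fintype.card V : ℝ) * ((Fintype.card V : ℝ) * (8 * G) ^ 2)) := by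
    rw [← nsmul_eq_mul]
    refine Finset.sum_le_card_nsmul _ _ _ fun L _ => ?_
    rw [← nsmul_eq_mul (Fintype.card V)]
    refine Finset.sum_le_card_nsmul _ _ _ fun i _ => ?_
    rw [← nsmul_eq_mul (Fintype.card V)]
    refine Finset.sum_le_card_nsmul _ _ _ fun k _ => ?_
    rw [← sq_abs]
    exact pow_le_pow_left₀ (abs_nonneg _) (h.inc_abs g hg hG0 hG L i k) 2
  rw [h1] at h2
  set N : ℝ := (Fintype.card V : ℝ)
  set W := ∑ L ∈ Om, (pst m g L - mst V Ns g) ^ 2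
  have hW : 0 ≤ W := Finset.sum_nonneg fun _ _ => sq_nonneg _
  have h3 : 8 * (N / 2) * W ≤ 8 * (N - 1) * W := by
    apply mul_le_mul_of_nonneg_right _ hW; linarith
  have h4 : N * (4 * W) ≤ N * (4 * ((Om.card : ℝ) * (16 * N * G ^ 2))) := by
    nlinarith
  have := le_of_mul_le_mul_left h4 (by linarith)
  linarith

theorem Setup.abs_le (h : Setup m Ns Om) (g : κ → κ → ℝ) (hg : ∀ s t, g s t = g t s)
    {G : ℝ} (hG0 : 0 ≤ G) (hG : ∀ s t, |g s t| ≤ G) :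
    ∑ L ∈ Om, |pst m g L - mst V Ns g| ≤
      (Om.card : ℝ) * (4 * √(Fintype.card V : ℝ) * G) := by
  have h1 := h.var_le g hg hG0 hG
  have h2 := sq_sum_le_card_mul_sum_sq (s := Om) (f := fun L => |pst m g L - mst V Ns g|)
  simp only [sq_abs] at h2
  refine abs_le_of_sq_le_sq' ?_ (by positivity) |>.2
  refine h2.trans ((mul_le_mul_of_nonneg_left h1 (by positivity)).trans_eq ?_)
  have : √(Fintype.card V : ℝ) ^ 2 = (Fintype.card V : ℝ) := Real.sq_sqrt (by positivity)
  rw [mul_pow, mul_pow, mul_pow, this]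
  ring

/-- symmetric indicator -/
noncomputable def ind (s t a b : κ) : ℝ :=
  ((if a = s ∧ b = t then 1 else 0) + (if b = s ∧ a = t then 1 else 0)) / 2

theorem ind_symm (s t a b : κ) : ind s t a b = ind s t b a := by
  unfold ind; rw [add_comm]

theorem ind_abs (s t a b : κ) : |ind s t a b| ≤ 1 := by
  unfold ind; split_ifs <;> norm_num

/-- ordered type counts -/
noncomputable def cnt (m : V → V) (s t : κ) (L : V → κ) : ℝ :=
  ∑ i, if L i = s ∧ L (m i) = t then 1 else 0

theorem Setup.cnt_eq (h : Setup m Ns Om) (s t : κ) (L : V → κ) :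
    cnt m s t L = pst m (ind s t) L := by
  unfold pst ind cnt
  rw [← Finset.sum_div, Finset.sum_add_distrib,
    ← sum_comp_invol m h.hm (fun i => if L (m i) = s ∧ L i = t then (1 : ℝ) else 0)]
  simp_rw [h.hm]
  ring

theorem cnt_nonneg (m : V → V) (s t : κ) (L : V → κ) : 0 ≤ cnt m s t L :=
  Finset.sum_nonneg fun i _ => by split_ifs <;> norm_num

theorem cnt_le (m : V → V) (s t : κ) (L : V → κ) : cnt m s t L ≤ (Fintype.card V : ℝ) := by
  have := Finset.sum_le_card_nsmul (univ : Finset V)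
    (fun i => if L i = s ∧ L (m i) = t then (1 : ℝ) else 0) 1
    (fun i _ => by split_ifs <;> norm_num)
  simpa [cnt] using this

theorem sum_types (m : V → V) (L : V → κ) (F : κ → κ → ℝ) :
    ∑ i, F (L i) (L (m i)) = ∑ s, ∑ t, cnt m s t L * F s t := by
  unfold cnt
  simp_rw [Finset.sum_mul]
  simp_rw [Finset.sum_comm (s := (univ : Finset κ)) (t := (univ : Finset V))]
  refine Finset.sum_congr rfl fun i _ => ?_
  simp [ite_and]

theorem Setup.card_pos (h : Setup m Ns Om) : (0 : ℝ) < (Om.card : ℝ) := by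
  exact_mod_cast h.ne.card_pos

theorem Setup.mean_cnt (h : Setup m Ns Om) (s t : κ) :
    ∑ L ∈ Om, cnt m s t L = (Om.card : ℝ) * mst V Ns (ind s t) := by
  have := h.mean (ind s t) (ind_symm s t)
  simp_rw [← h.cnt_eq] at this
  rw [Finset.sum_sub_distrib, Finset.sum_const, nsmul_eq_mul] at this
  linarith

theorem Setup.mu_nonneg (h : Setup m Ns Om) (s t : κ) : 0 ≤ mst V Ns (ind s t) := by
  have h1 := h.mean_cnt s t
  have h2 : 0 ≤ ∑ L ∈ Om, cnt m s t L := Finset.sum_nonneg fun L _ => cnt_nonneg m s t L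
  rw [h1] at h2
  exact nonneg_of_mul_nonneg_right h2 h.card_pos

theorem Setup.mu_le (h : Setup m Ns Om) (s t : κ) :
    mst V Ns (ind s t) ≤ (Fintype.card V : ℝ) := by
  have h1 := h.mean_cnt s t
  have h2 := Finset.sum_le_card_nsmul Om _ _ fun L _ => cnt_le m s t L
  rw [h1, nsmul_eq_mul] at h2
  exact le_of_mul_le_mul_left h2 h.card_pos

theorem Setup.prod_dev (h : Setup m Ns Om) (s t s' t' : κ) :
    ∑ L ∈ Om, |cnt m s t L * cnt m s' t' L - mst V Ns (ind s t) * mst V Ns (ind s' t')| ≤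
      (Om.card : ℝ) * (8 * (Fintype.card V : ℝ) * √(Fintype.card V : ℝ)) := by
  have h1 := h.abs_le (ind s t) (ind_symm s t) zero_le_one (ind_abs s t)
  have h2 := h.abs_le (ind s' t') (ind_symm s' t') zero_le_one (ind_abs s' t')
  simp_rw [← h.cnt_eq] at h1 h2
  set N : ℝ := (Fintype.card V : ℝ) with hN
  have hN0 : 0 ≤ N := by positivity
  have h3 : ∀ L ∈ Om,
      |cnt m s t L * cnt m s' t' L - mst V Ns (ind s t) * mst V Ns (ind s' t')| ≤
      N * |cnt m s t L - mst V Ns (ind s t)| + N * |cnt m s' t' L - mst V Ns (ind s' t')| := by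
    intro L _
    have e : cnt m s t L * cnt m s' t' L - mst V Ns (ind s t) * mst V Ns (ind s' t') =
      cnt m s' t' L * (cnt m s t L - mst V Ns (ind s t)) +
        mst V Ns (ind s t) * (cnt m s' t' L - mst V Ns (ind s' t')) := by ring
    rw [e]
    refine (abs_add_le _ _).trans (add_le_add ?_ ?_)
    · rw [abs_mul, abs_of_nonneg (cnt_nonneg _ _ _ _)]
      exact mul_le_mul_of_nonneg_right (cnt_le _ _ _ _) (abs_nonneg _)
    · rw [abs_mul, abs_of_nonneg (h.mu_nonneg _ _)]
      exact mul_le_mul_of_nonneg_right (h.mu_le _ _) (abs_nonneg _)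
  refine (Finset.sum_le_sum h3).trans ?_
  rw [Finset.sum_add_distrib, ← Finset.mul_sum, ← Finset.mul_sum]
  have h4 := mul_le_mul_of_nonneg_left h1 hN0
  have h5 := mul_le_mul_of_nonneg_left h2 hN0
  linarith

/-- total squared increments -/
def vst (m : V → V) (g : κ → κ → ℝ) (L : V → κ) : ℝ := ∑ i, ∑ k, (inc m g L i k) ^ 2

/-- squared increment as function of types -/
def hst (g : κ → κ → ℝ) (s t s' t' : κ) : ℝ :=
  (2 * (g s' t + g s t' - g s t - g s' t')) ^ 2

/-- approximate mean of `vst` -/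
noncomputable def cst (V : Type*) [Fintype V] (Ns : κ → ℕ) (g : κ → κ → ℝ) : ℝ :=
  ∑ s, ∑ t, ∑ s', ∑ t', (mst V Ns (ind s t) * mst V Ns (ind s' t')) * hst g s t s' t'

theorem hst_le (g : κ → κ → ℝ) {G : ℝ} (hG : ∀ s t, |g s t| ≤ G) (s t s' t' : κ) :
    |hst g s t s' t'| ≤ 64 * G ^ 2 := by
  unfold hst
  have h1 := _root_.abs_le.1 (hG s' t)
  have h2 := _root_.abs_le.1 (hG s t')
  have h3 := _root_.abs_le.1 (hG s t)
  have h4 := _root_.abs_le.1 (hG s' t')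
  rw [abs_of_nonneg (sq_nonneg _)]
  have : (64 * G ^ 2) = (8 * G) ^ 2 := by ring
  rw [this]
  apply sq_le_sq'  <;> linarith

theorem Setup.vst_eq (h : Setup m Ns Om) (g : κ → κ → ℝ) (hg : ∀ s t, g s t = g t s)
    (L : V → κ) : vst m g L =
      (∑ s, ∑ t, ∑ s', ∑ t', (cnt m s t L * cnt m s' t' L) * hst g s t s' t') -
        ∑ i, (inc0 m g L i (m i)) ^ 2 := by
  have h1 : ∀ i, ∑ k, inc m g L i k ^ 2 = ∑ k, inc0 m g L i k ^ 2 - inc0 m g L i (m i) ^ 2 := by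
    intro i
    rw [← Finset.add_sum_erase univ _ (Finset.mem_univ (m i)),
      ← Finset.add_sum_erase univ (fun k => inc0 m g L i k ^ 2) (Finset.mem_univ (m i)),
      inc_partner m h.hm g hg, add_sub_cancel_left]
    rw [zero_pow two_ne_zero, zero_add]
    exact Finset.sum_congr rfl fun k hk => by
      rw [inc_eq m h.hm h.hf g hg L i k (Finset.ne_of_mem_erase hk)]
  unfold vst
  simp_rw [h1]
  rw [Finset.sum_sub_distrib]
  congr 1
  have h2 : ∀ i, ∑ k, inc0 m g L i k ^ 2 =
      ∑ s', ∑ t', cnt m s' t' L * hst g (L i) (L (m i)) s' t' := by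
    intro i
    exact sum_types m L (fun s' t' => hst g (L i) (L (m i)) s' t')
  simp_rw [h2]
  rw [sum_types m L (fun s t => ∑ s', ∑ t', cnt m s' t' L * hst g s t s' t')]
  simp_rw [Finset.mul_sum, mul_assoc]

theorem Setup.vst_dev (h : Setup m Ns Om) (g : κ → κ → ℝ) (hg : ∀ s t, g s t = g t s)
    {G : ℝ} (hG : ∀ s t, |g s t| ≤ G) :
    ∑ L ∈ Om, |vst m g L - cst V Ns g| ≤ (Om.card : ℝ) *
      ((512 * (Fintype.card κ : ℝ) ^ 4 + 64) * G ^ 2 *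
        ((Fintype.card V : ℝ) * √(Fintype.card V : ℝ))) := by
  have hN := h.hN
  set N : ℝ := (Fintype.card V : ℝ) with hNd
  set k : ℝ := (Fintype.card κ : ℝ) with hk
  have h1 : ∀ L ∈ Om, |vst m g L - cst V Ns g| ≤
      (∑ s, ∑ t, ∑ s', ∑ t', |cnt m s t L * cnt m s' t' L -
        mst V Ns (ind s t) * mst V Ns (ind s' t')| * (64 * G ^ 2)) + N * (64 * G ^ 2) := by
    intro L _
    rw [h.vst_eq g hg, cst, sub_right_comm]
    refine (abs_sub _ _).trans (add_le_add ?_ ?_)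
    · simp_rw [← Finset.sum_sub_distrib, ← sub_mul]
      refine (Finset.abs_sum_le_sum_abs _ _).trans (Finset.sum_le_sum fun s _ => ?_)
      refine (Finset.abs_sum_le_sum_abs _ _).trans (Finset.sum_le_sum fun t _ => ?_)
      refine (Finset.abs_sum_le_sum_abs _ _).trans (Finset.sum_le_sum fun s' _ => ?_)
      refine (Finset.abs_sum_le_sum_abs _ _).trans (Finset.sum_le_sum fun t' _ => ?_)
      rw [abs_mul]
      exact mul_le_mul_of_nonneg_left (hst_le g hG _ _ _ _) (abs_nonneg _)
    · rw [abs_of_nonneg (Finset.sum_nonneg fun _ _ => sq_nonneg _), hNd, ← nsmul_eq_mul]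
      refine Finset.sum_le_card_nsmul _ _ _ fun i _ => ?_
      have e : (64 * G ^ 2) = (8 * G) ^ 2 := by ring
      rw [← sq_abs, e]
      exact pow_le_pow_left₀ (abs_nonneg _) (inc0_abs m g hG L i (m i)) 2
  refine (Finset.sum_le_sum h1).trans ?_
  rw [Finset.sum_add_distrib, Finset.sum_const, nsmul_eq_mul]
  have h2 : ∑ L ∈ Om, (∑ s, ∑ t, ∑ s', ∑ t', |cnt m s t L * cnt m s' t' L -
        mst V Ns (ind s t) * mst V Ns (ind s' t')| * (64 * G ^ 2)) ≤
      k * (k * (k * (k * ((Om.card : ℝ) * (8 * N * √N) * (64 * G ^ 2))))) := by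
    rw [Finset.sum_comm, hk, ← nsmul_eq_mul]
    refine Finset.sum_le_card_nsmul _ _ _ fun s _ => ?_
    rw [Finset.sum_comm, ← nsmul_eq_mul]
    refine Finset.sum_le_card_nsmul _ _ _ fun t _ => ?_
    rw [Finset.sum_comm, ← nsmul_eq_mul]
    refine Finset.sum_le_card_nsmul _ _ _ fun s' _ => ?_
    rw [Finset.sum_comm, ← nsmul_eq_mul]
    refine Finset.sum_le_card_nsmul _ _ _ fun t' _ => ?_
    rw [← Finset.sum_mul]
    exact mul_le_mul_of_nonneg_right (h.prod_dev s t s' t') (by positivity)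
  have h3 : N ≤ N * √N := by
    have : 1 ≤ √N := by rw [Real.one_le_sqrt]; linarith
    nlinarith
  have h4 : (Om.card : ℝ) * (N * (64 * G ^ 2)) ≤ (Om.card : ℝ) * ((N * √N) * (64 * G ^ 2)) := by
    gcongr
  calc _ ≤ _ := add_le_add h2 h4
    _ = _ := by ring

theorem Setup.var_lower (h : Setup m Ns Om) (g : κ → κ → ℝ) (hg : ∀ s t, g s t = g t s)
    (hd : ∀ s, g s s = 0) (s t : κ) (hst : s ≠ t) :
    16 * (g s t) ^ 2 * ((Om.card : ℝ) * (mst V Ns (ind s s) * mst V Ns (ind t t) -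
      8 * (Fintype.card V : ℝ) * √(Fintype.card V : ℝ))) ≤
    8 * ((Fintype.card V : ℝ) - 1) * ∑ L ∈ Om, (pst m g L - mst V Ns g) ^ 2 := by
  rw [← h.var g hg]
  have h1 : ∀ L, 16 * (g s t) ^ 2 * (cnt m s s L * cnt m t t L) ≤
      ∑ i, ∑ k, inc m g L i k ^ 2 := by
    intro L
    unfold cnt
    rw [Finset.sum_mul_sum, Finset.mul_sum]
    refine Finset.sum_le_sum fun i _ => ?_
    rw [Finset.mul_sum]
    refine Finset.sum_le_sum fun k _ => ?_
    by_cases hi : L i = s ∧ L (m i) = s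
    · by_cases hk : L k = t ∧ L (m k) = t
      · rw [if_pos hi, if_pos hk, inc_eq m h.hm h.hf g hg L i k, inc0, hi.1, hi.2, hk.1, hk.2,
          hd, hd, hg t s]
        · apply le_of_eq; ring
        · intro e
          apply hst
          rw [← hk.1, e, hi.2]
      · rw [if_neg hk, mul_zero, mul_zero]; positivity
    · rw [if_neg hi, zero_mul, mul_zero]; positivity
  refine le_trans ?_ (Finset.sum_le_sum fun L _ => h1 L)
  rw [← Finset.mul_sum]
  refine mul_le_mul_of_nonneg_left ?_ (by positivity)
  have h2 := h.prod_dev s s t t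
  have h3 : ∑ L ∈ Om, (mst V Ns (ind s s) * mst V Ns (ind t t) - cnt m s s L * cnt m t t L) ≤
      ∑ L ∈ Om, |cnt m s s L * cnt m t t L - mst V Ns (ind s s) * mst V Ns (ind t t)| := by
    refine Finset.sum_le_sum fun L _ => ?_
    rw [abs_sub_comm]
    exact le_abs_self _
  rw [Finset.sum_sub_distrib, Finset.sum_const, nsmul_eq_mul] at h3
  linarith

end Abstract2

section Abstract3

theorem exp_bound (x : ℝ) : ‖Complex.exp (Complex.I * x) - 1 - Complex.I * x‖ ≤ 2 * x ^ 2 := by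
  by_cases hx : |x| ≤ 1
  · have h := Complex.norm_exp_sub_one_sub_id_le (x := Complex.I * x) (by simpa using hx)
    have e : ‖Complex.I * (x : ℂ)‖ = |x| := by simp
    rw [e, sq_abs] at h
    nlinarith [sq_nonneg x]
  · push Not at hx
    have h := Real.norm_exp_I_mul_ofReal_sub_one_le (x := x)
    have e : ‖Complex.I * (x : ℂ)‖ = |x| := by simp
    have h2 := norm_sub_le (Complex.exp (Complex.I * x) - 1) (Complex.I * x)
    rw [e] at h2
    rw [Real.norm_eq_abs] at h
    rw [← sq_abs]
    nlinarith

variable {V κ : Type*} [Fintype V] [DecidableEq V] [Fintype κ] [DecidableEq κ]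
variable {m : V → V} {Ns : κ → ℕ} {Om : Finset (V → κ)}

/-- the exponential -/
noncomputable def ech (m : V → V) (Ns : κ → ℕ) (g : κ → κ → ℝ) (u : ℝ) (L : V → κ) : ℂ :=
  Complex.exp (Complex.I * ((u * (pst m g L - mst V Ns g) : ℝ) : ℂ))

theorem ech_norm (m : V → V) (Ns : κ → ℕ) (g : κ → κ → ℝ) (u : ℝ) (L : V → κ) :
    ‖ech m Ns g u L‖ = 1 := Complex.norm_exp_I_mul_ofReal _

theorem Setup.stein (h : Setup m Ns Om) (g : κ → κ → ℝ) (hg : ∀ s t, g s t = g t s)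
    {G v : ℝ} (hG0 : 0 ≤ G) (hG : ∀ s t, |g s t| ≤ G)
    (hv : ∑ L ∈ Om, (pst m g L - mst V Ns g) ^ 2 = (Om.card : ℝ) * v) (u : ℝ) (hu : |u| ≤ 1) :
    ‖∑ L ∈ Om, ((pst m g L - mst V Ns g : ℝ) : ℂ) * ech m Ns g u L
      - Complex.I * u * v * ∑ L ∈ Om, ech m Ns g u L‖ ≤
    (Om.card : ℝ) * (256 * (Fintype.card V : ℝ) * G ^ 3 +
      (512 * (Fintype.card κ : ℝ) ^ 4 + 64) * G ^ 2 * √(Fintype.card V : ℝ)) := by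
  have hN := h.hN
  have hdir := h.dir g hg (ech m Ns g u)
  have hvar := h.var g hg
  have hdev := h.vst_dev g hg hG
  rw [hv] at hvar
  set N : ℝ := (Fintype.card V : ℝ) with hNd
  set C : ℝ := 512 * (Fintype.card κ : ℝ) ^ 4 + 64 with hC
  have hC0 : 0 ≤ C := by positivity
  set M : ℝ := (Om.card : ℝ) with hM
  have hM0 : 0 ≤ M := h.card_pos.le
  set E := ∑ L ∈ Om, ech m Ns g u L with hE
  set T := ∑ L ∈ Om, ((pst m g L - mst V Ns g : ℝ) : ℂ) * ech m Ns g u L with hT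
  have hEM : ‖E‖ ≤ M := by
    refine (norm_sum_le _ _).trans_eq ?_
    simp_rw [ech_norm]
    simp [hM]
  -- step 1
  have s1 : ‖(∑ L ∈ Om, ∑ i, ∑ k, (inc m g L i k : ℂ) *
      (ech m Ns g u (L ∘ Equiv.swap i k) - ech m Ns g u L)) -
      Complex.I * u * ∑ L ∈ Om, (vst m g L : ℂ) * ech m Ns g u L‖ ≤
      M * (N * (N * (1024 * G ^ 3))) := by
    have e1 : Complex.I * u * ∑ L ∈ Om, (vst m g L : ℂ) * ech m Ns g u L =
        ∑ L ∈ Om, ∑ i, ∑ k, (inc m g L i k : ℂ) *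
          (Complex.I * u * (inc m g L i k : ℂ) * ech m Ns g u L) := by
      rw [Finset.mul_sum]
      refine Finset.sum_congr rfl fun L _ => ?_
      unfold vst
      push_cast
      rw [Finset.sum_mul, Finset.mul_sum]
      refine Finset.sum_congr rfl fun i _ => ?_
      rw [Finset.sum_mul, Finset.mul_sum]
      refine Finset.sum_congr rfl fun k _ => ?_
      ring
    rw [e1]
    simp_rw [← Finset.sum_sub_distrib, ← mul_sub]
    rw [hM, ← nsmul_eq_mul]
    refine (norm_sum_le _ _).trans (Finset.sum_le_card_nsmul _ _ _ fun L _ => ?_)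
    rw [hNd, ← nsmul_eq_mul (Fintype.card V)]
    refine (norm_sum_le _ _).trans (Finset.sum_le_card_nsmul _ _ _ fun i _ => ?_)
    rw [← nsmul_eq_mul (Fintype.card V)]
    refine (norm_sum_le _ _).trans (Finset.sum_le_card_nsmul _ _ _ fun k _ => ?_)
    have hi := h.inc_abs g hg hG0 hG L i k
    have e2 : ech m Ns g u (L ∘ Equiv.swap i k) - ech m Ns g u L
        - Complex.I * u * (inc m g L i k : ℂ) * ech m Ns g u L =
        ech m Ns g u L * (Complex.exp (Complex.I * ((u * inc m g L i k : ℝ) : ℂ)) - 1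
          - Complex.I * ((u * inc m g L i k : ℝ) : ℂ)) := by
      have e3 : ech m Ns g u (L ∘ Equiv.swap i k) = ech m Ns g u L *
          Complex.exp (Complex.I * ((u * inc m g L i k : ℝ) : ℂ)) := by
        unfold ech inc
        rw [← Complex.exp_add]
        congr 1
        push_cast
        ring
      rw [e3]
      push_cast
      ring
    rw [e2, norm_mul, norm_mul, ech_norm, one_mul, Complex.norm_real, Real.norm_eq_abs]
    have e4 := exp_bound (u * inc m g L i k)
    have e5 : (u * inc m g L i k) ^ 2 ≤ (8 * G) ^ 2 := by
      rw [← sq_abs, abs_mul]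
      refine pow_le_pow_left₀ (by positivity) ?_ 2
      calc |u| * |inc m g L i k| ≤ 1 * (8 * G) := by gcongr
        _ = _ := one_mul _
    calc _ ≤ (8 * G) * (2 * (8 * G) ^ 2) := by
          refine mul_le_mul hi (e4.trans (by linarith)) (norm_nonneg _) (by positivity)
      _ = _ := by ring
  rw [hdir] at s1
  -- step 2
  have s2 : ‖∑ L ∈ Om, (vst m g L : ℂ) * ech m Ns g u L - (cst V Ns g : ℂ) * E‖ ≤
      M * (C * G ^ 2 * (N * √N)) := by
    rw [hE, Finset.mul_sum, ← Finset.sum_sub_distrib]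
    refine (norm_sum_le _ _).trans (le_trans (Finset.sum_le_sum fun L _ => ?_) hdev)
    rw [← sub_mul, norm_mul, ech_norm, mul_one, ← Complex.ofReal_sub, Complex.norm_real,
      Real.norm_eq_abs]
  have s3 : |8 * (N - 1) * (M * v) - M * cst V Ns g| ≤ M * (C * G ^ 2 * (N * √N)) := by
    rw [← hvar]
    have : ∑ L ∈ Om, ∑ i, ∑ k, inc m g L i k ^ 2 - M * cst V Ns g =
        ∑ L ∈ Om, (vst m g L - cst V Ns g) := by
      rw [Finset.sum_sub_distrib, Finset.sum_const, nsmul_eq_mul]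
      rfl
    rw [this]
    exact (Finset.abs_sum_le_sum_abs _ _).trans hdev
  have s4 : ‖(cst V Ns g : ℂ) * E - (8 * (N - 1) * v : ℝ) * E‖ ≤ M * (C * G ^ 2 * (N * √N)) := by
    rw [← sub_mul, ← Complex.ofReal_sub, norm_mul, Complex.norm_real, Real.norm_eq_abs]
    refine (mul_le_mul_of_nonneg_left hEM (abs_nonneg _)).trans (le_trans (le_of_eq ?_) s3)
    rw [abs_sub_comm, ← abs_of_nonneg hM0, ← abs_mul, abs_of_nonneg hM0]
    congr 1
    ring
  have s5 : ‖(8 * ((N - 1 : ℝ) : ℂ)) * (T - Complex.I * u * v * E)‖ ≤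
      M * (N * (N * (1024 * G ^ 3))) + 2 * (M * (C * G ^ 2 * (N * √N))) := by
    have e : (8 * ((N - 1 : ℝ) : ℂ)) * (T - Complex.I * u * v * E) =
      (8 * ((N - 1 : ℝ) : ℂ) * T - Complex.I * u * ∑ L ∈ Om, (vst m g L : ℂ) * ech m Ns g u L)
      + Complex.I * u * ((∑ L ∈ Om, (vst m g L : ℂ) * ech m Ns g u L - (cst V Ns g : ℂ) * E)
        + ((cst V Ns g : ℂ) * E - (8 * (N - 1) * v : ℝ) * E)) := by
      push_cast
      ring
    rw [e]
    refine (norm_add_le _ _).trans (add_le_add s1 ?_)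
    rw [norm_mul, norm_mul, Complex.norm_I, one_mul, Complex.norm_real, Real.norm_eq_abs]
    calc _ ≤ 1 * _ := mul_le_mul_of_nonneg_right hu (norm_nonneg _)
      _ ≤ _ := by
        rw [one_mul, two_mul]
        exact (norm_add_le _ _).trans (add_le_add s2 s4)
  rw [norm_mul] at s5
  have e6 : ‖(8 * ((N - 1 : ℝ) : ℂ))‖ = 8 * (N - 1) := by
    rw [norm_mul, Complex.norm_real, Real.norm_eq_abs, abs_of_nonneg (by linarith)]
    simp
  rw [e6] at s5
  set R := ‖T - Complex.I * u * v * E‖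
  have hR : 0 ≤ R := norm_nonneg _
  have s6 : 8 * (N / 2) * R ≤ 8 * (N - 1) * R := by
    apply mul_le_mul_of_nonneg_right _ hR; linarith
  have s7 : 0 ≤ M * (C * G ^ 2 * (N * √N)) := by positivity
  have s8 : (4 * N) * R ≤ (4 * N) * (M * (256 * N * G ^ 3 + C * G ^ 2 * √N)) := by
    nlinarith
  exact le_of_mul_le_mul_left s8 (by linarith)

theorem Setup.clt (h : Setup m Ns Om) (g : κ → κ → ℝ) (hg : ∀ s t, g s t = g t s)
    {G v : ℝ} (hG0 : 0 ≤ G) (hG : ∀ s t, |g s t| ≤ G) (hv0 : 0 ≤ v)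
    (hv : ∑ L ∈ Om, (pst m g L - mst V Ns g) ^ 2 = (Om.card : ℝ) * v) :
    ‖(∑ L ∈ Om, ech m Ns g 1 L) / (Om.card : ℂ) - Complex.exp (-(v : ℂ) / 2)‖ ≤
    256 * (Fintype.card V : ℝ) * G ^ 3 +
      (512 * (Fintype.card κ : ℝ) ^ 4 + 64) * G ^ 2 * √(Fintype.card V : ℝ) := by
  set η := 256 * (Fintype.card V : ℝ) * G ^ 3 +
      (512 * (Fintype.card κ : ℝ) ^ 4 + 64) * G ^ 2 * √(Fintype.card V : ℝ) with hη
  have hM := h.card_pos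
  have hMC : (Om.card : ℂ) ≠ 0 := by exact_mod_cast hM.ne'
  set ψ : ℝ → ℂ := fun u => (∑ L ∈ Om, ech m Ns g u L) / (Om.card : ℂ) *
    Complex.exp ((v : ℂ) * u ^ 2 / 2) with hψ
  have hech : ∀ (u : ℝ) (L : V → κ), HasDerivAt (fun u => ech m Ns g u L)
      (ech m Ns g u L * (Complex.I * ((pst m g L - mst V Ns g : ℝ) : ℂ))) u := by
    intro u L
    unfold ech
    have h1 : HasDerivAt (fun u : ℝ => Complex.I * ((u * (pst m g L - mst V Ns g) : ℝ) : ℂ))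
        (Complex.I * ((1 * (pst m g L - mst V Ns g) : ℝ) : ℂ)) u :=
      (((hasDerivAt_id u).mul_const _).ofReal_comp).const_mul _
    rw [one_mul] at h1
    exact h1.cexp
  have hexp : ∀ u : ℝ, HasDerivAt (fun u : ℝ => Complex.exp ((v : ℂ) * u ^ 2 / 2))
      (Complex.exp ((v : ℂ) * u ^ 2 / 2) * ((v : ℂ) * u)) u := by
    intro u
    have h1 : HasDerivAt (fun u : ℝ => ((v * u ^ 2 / 2 : ℝ) : ℂ))
        ((v * (2 * u) / 2 : ℝ) : ℂ) u := by
      have := (((hasDerivAt_pow 2 u).const_mul v).div_const 2).ofReal_comp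
      simpa using this
    have h2 := h1.cexp
    convert h2 using 1
    · funext x; push_cast; rfl
    · push_cast; ring_nf
  have hder : ∀ u : ℝ, HasDerivAt ψ
      (Complex.I * (∑ L ∈ Om, ((pst m g L - mst V Ns g : ℝ) : ℂ) * ech m Ns g u L
        - Complex.I * u * v * ∑ L ∈ Om, ech m Ns g u L) / (Om.card : ℂ) *
        Complex.exp ((v : ℂ) * u ^ 2 / 2)) u := by
    intro u
    have h1 := ((HasDerivAt.fun_sum (u := Om) fun L _ => hech u L).div_const (Om.card : ℂ)).mul
      (hexp u)
    refine h1.congr_deriv ?_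
    have e : ∑ L ∈ Om, ech m Ns g u L * (Complex.I * ((pst m g L - mst V Ns g : ℝ) : ℂ)) =
        Complex.I * ∑ L ∈ Om, ((pst m g L - mst V Ns g : ℝ) : ℂ) * ech m Ns g u L := by
      rw [Finset.mul_sum]
      exact Finset.sum_congr rfl fun L _ => by ring
    rw [e]
    have : Complex.I * (Complex.I * u * v * ∑ L ∈ Om, ech m Ns g u L) =
      - (u * v * ∑ L ∈ Om, ech m Ns g u L) := by
      rw [← mul_assoc, ← mul_assoc, ← mul_assoc, Complex.I_mul_I]; ring
    rw [mul_sub, this]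
    ring
  have hexpn : ∀ u : ℝ, ‖Complex.exp ((v : ℂ) * u ^ 2 / 2)‖ = Real.exp (v * u ^ 2 / 2) := by
    intro u
    rw [← Complex.norm_of_nonneg (Real.exp_pos _).le]
    push_cast
    rfl
  have hbound : ∀ u ∈ Set.Ico (0 : ℝ) 1, ‖Complex.I * (∑ L ∈ Om, ((pst m g L - mst V Ns g : ℝ) : ℂ)
        * ech m Ns g u L
        - Complex.I * u * v * ∑ L ∈ Om, ech m Ns g u L) / (Om.card : ℂ) *
        Complex.exp ((v : ℂ) * u ^ 2 / 2)‖ ≤ η * Real.exp (v / 2) := by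
    intro u hu
    have h1 := h.stein g hg hG0 hG hv u (by rw [abs_of_nonneg hu.1]; exact hu.2.le)
    rw [← hη] at h1
    rw [norm_mul, norm_div, norm_mul, Complex.norm_I, one_mul, Complex.norm_natCast, hexpn]
    have hη0 : 0 ≤ η := by positivity
    refine mul_le_mul ?_ ?_ (Real.exp_pos _).le hη0
    · rw [div_le_iff₀ hM]; exact h1.trans_eq (mul_comm _ _)
    · apply Real.exp_le_exp.2
      have : u ^ 2 ≤ 1 := pow_le_one₀ hu.1 hu.2.le
      nlinarith
  have hmv := norm_image_sub_le_of_norm_deriv_le_segment' (f := ψ) (a := 0) (b := 1)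
    (fun u _ => (hder u).hasDerivWithinAt) hbound 1 (by simp)
  have hψ0 : ψ 0 = 1 := by
    simp [hψ, ech, hMC]
  have hψ1 : ψ 1 = (∑ L ∈ Om, ech m Ns g 1 L) / (Om.card : ℂ) * Complex.exp ((v : ℂ) / 2) := by
    simp [hψ]
  rw [hψ0, hψ1, sub_zero, mul_one] at hmv
  have hfin : (∑ L ∈ Om, ech m Ns g 1 L) / (Om.card : ℂ) - Complex.exp (-(v : ℂ) / 2) =
     ((∑ L ∈ Om, ech m Ns g 1 L) / (Om.card : ℂ) * Complex.exp ((v : ℂ) / 2) - 1) *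
      Complex.exp (-(v : ℂ) / 2) := by
    rw [sub_mul, mul_assoc, ← Complex.exp_add, one_mul]
    have : (v : ℂ) / 2 + -(v : ℂ) / 2 = 0 := by ring
    rw [this, Complex.exp_zero, mul_one]
  rw [hfin, norm_mul]
  have hen : ‖Complex.exp (-(v : ℂ) / 2)‖ = Real.exp (-v / 2) := by
    rw [← Complex.norm_of_nonneg (Real.exp_pos _).le]
    push_cast
    rfl
  rw [hen]
  calc _ ≤ η * Real.exp (v / 2) * Real.exp (-v / 2) :=
        mul_le_mul_of_nonneg_right hmv (Real.exp_pos _).le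
    _ = η := by
      rw [mul_assoc, ← Real.exp_add]
      have : v / 2 + -v / 2 = 0 := by ring
      rw [this, Real.exp_zero, mul_one]

end Abstract3


/-- partner -/
def ptn (I : ℕ) (i : Fin (2 * I)) : Fin (2 * I) :=
  if h : i.val % 2 = 0 then ⟨i.val + 1, by have := i.isLt; omega⟩
  else ⟨i.val - 1, by have := i.isLt; omega⟩

theorem ptn_ptn (I : ℕ) (i : Fin (2 * I)) : ptn I (ptn I i) = i := by
  have := i.isLt
  apply Fin.ext
  unfold ptn
  split_ifs with h1 h2 h2 <;> simp at h2 ⊢ <;> omega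

theorem ptn_ne (I : ℕ) (i : Fin (2 * I)) : ptn I i ≠ i := by
  intro h
  have h' := congrArg Fin.val h
  unfold ptn at h'
  split_ifs at h' with h1 <;> simp at h' <;> omega

theorem ptn_ep1 {I : ℕ} (j : Fin I) : ptn I (ep1 j) = ep2 j := by
  unfold ptn ep1 ep2
  simp

theorem ptn_ep2 {I : ℕ} (j : Fin I) : ptn I (ep2 j) = ep1 j := by
  rw [← ptn_ep1, ptn_ptn]

theorem sum_ep {I : ℕ} (F : Fin (2 * I) → ℝ) : ∑ i, F i = ∑ j, (F (ep1 j) + F (ep2 j)) := by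
  have hb : Function.Bijective (Sum.elim (ep1 (I := I)) (ep2 (I := I))) := by
    constructor
    · rintro (a | a) (b | b) h <;> have h' := congrArg Fin.val h <;> simp [ep1, ep2] at h' ⊢
      · exact Fin.ext h'
      · omega
      · omega
      · exact Fin.ext h'
    · intro i
      have hi := i.isLt
      by_cases h : i.val % 2 = 0
      · refine ⟨Sum.inl ⟨i.val / 2, by omega⟩, Fin.ext ?_⟩
        simp [ep1]; omega
      · refine ⟨Sum.inr ⟨i.val / 2, by omega⟩, Fin.ext ?_⟩
        simp [ep2]; omega
  rw [← (Equiv.ofBijective _ hb).sum_comp F, Fintype.sum_sum_type, ← Finset.sum_add_distrib]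
  rfl

theorem pair_iff {α : Type*} [DecidableEq α] (a b s t : α) (h : s ≠ t) :
    (({a, b} : Finset α) = {s, t}) ↔ ((a = s ∧ b = t) ∨ (b = s ∧ a = t)) := by
  constructor
  · intro e
    have ha : a ∈ ({s, t} : Finset α) := e ▸ by simp
    have hb : b ∈ ({s, t} : Finset α) := e ▸ by simp
    have hs : s ∈ ({a, b} : Finset α) := e ▸ by simp
    have ht : t ∈ ({a, b} : Finset α) := e ▸ by simp
    simp only [Finset.mem_insert, Finset.mem_singleton] at ha hb hs ht
    grind
  · rintro (⟨rfl, rfl⟩ | ⟨rfl, rfl⟩)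
    · rfl
    · exact Finset.pair_comm _ _

theorem crossCount_eq (I K : ℕ) (L : Fin (2 * I) → Fin K) (s t : Fin K) (h : s ≠ t) :
    (crossCount I K L s t : ℝ) = cnt (ptn I) s t L := by
  unfold crossCount cnt
  rw [sum_ep, Finset.card_filter]
  push_cast
  refine Finset.sum_congr rfl fun j _ => ?_
  rw [ptn_ep1, ptn_ep2]
  simp only [pair_iff _ _ s t h]
  split_ifs <;> simp_all

theorem crossCount_eq' {I K : ℕ} (L : Fin (2 * I) → Fin K) (q : Pairs K) :
    (crossCount I K L q.1.1 q.1.2 : ℝ) = cnt (ptn I) q.1.1 q.1.2 L :=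
  crossCount_eq I K L _ _ q.2.ne

theorem setup (I K : ℕ) (Nc : Fin K → ℕ) (hI : 1 ≤ I) (hne : (labelings I K Nc).Nonempty) :
    Setup (ptn I) Nc (labelings I K Nc) where
  hm := ptn_ptn I
  hf := ptn_ne I
  hL := fun L hL => by simpa [labelings] using hL
  hO := fun L hL i k => by
    simp only [labelings, Finset.mem_filter, Finset.mem_univ, true_and] at hL ⊢
    intro s
    rw [← hL s]
    refine Finset.card_bij (fun v _ => Equiv.swap i k v) ?_ ?_ ?_
    · intro v hv; simpa using hv
    · intro a _ b _ h; exact (Equiv.swap i k).injective h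
    · intro b hb
      exact ⟨Equiv.swap i k b, by simpa using hb, by simp⟩
  ne := hne
  hN := by
    rw [Fintype.card_fin]; push_cast
    have : (1 : ℝ) ≤ I := by exact_mod_cast hI
    linarith

/-- kernel attached to a coefficient vector -/
noncomputable def gc {K : ℕ} (c : Pairs K → ℝ) (a b : Fin K) : ℝ :=
  ∑ q : Pairs K, c q * ind q.1.1 q.1.2 a b

theorem gc_symm {K : ℕ} (c : Pairs K → ℝ) (a b : Fin K) : gc c a b = gc c b a := by
  unfold gc
  simp_rw [ind_symm _ _ a b]

theorem gc_diag {K : ℕ} (c : Pairs K → ℝ) (a : Fin K) : gc c a a = 0 := by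
  unfold gc
  refine Finset.sum_eq_zero fun q _ => ?_
  have h := q.2.ne
  have h1 : ¬ (a = q.1.1 ∧ a = q.1.2) := fun e => h (e.1.symm.trans e.2)
  simp [ind, h1]

section
variable {I K : ℕ} {Nc : Fin K → ℕ} (hs : Setup (ptn I) Nc (labelings I K Nc))
include hs

theorem expct_cross (q : Pairs K) :
    expct I K Nc (fun L => (crossCount I K L q.1.1 q.1.2 : ℝ)) =
      mst (Fin (2 * I)) Nc (ind q.1.1 q.1.2) := by
  unfold expct
  simp_rw [crossCount_eq I K _ _ _ q.2.ne]
  rw [hs.mean_cnt]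
  have := hs.card_pos
  field_simp

theorem pst_gc (c : Pairs K → ℝ) (L : Fin (2 * I) → Fin K) :
    pst (ptn I) (gc c) L = ∑ q : Pairs K, c q * (crossCount I K L q.1.1 q.1.2 : ℝ) := by
  simp_rw [crossCount_eq', hs.cnt_eq]
  unfold pst gc
  rw [Finset.sum_comm]
  simp_rw [Finset.mul_sum]

theorem mst_gc (c : Pairs K → ℝ) :
    mst (Fin (2 * I)) Nc (gc c) =
      ∑ q : Pairs K, c q * mst (Fin (2 * I)) Nc (ind q.1.1 q.1.2) := by
  have h1 := hs.mean (gc c) (gc_symm c)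
  have hM := hs.card_pos
  rw [Finset.sum_sub_distrib, Finset.sum_const, nsmul_eq_mul] at h1
  simp_rw [pst_gc hs, crossCount_eq'] at h1
  rw [Finset.sum_comm] at h1
  simp_rw [← Finset.mul_sum, hs.mean_cnt] at h1
  apply mul_left_cancel₀ hM.ne'
  rw [Finset.mul_sum, ← sub_eq_zero.1 h1]
  exact Finset.sum_congr rfl fun q _ => by ring

theorem pst_sub (c : Pairs K → ℝ) (L : Fin (2 * I) → Fin K) :
    pst (ptn I) (gc c) L - mst (Fin (2 * I)) Nc (gc c) =
      c ⬝ᵥ (fun q : Pairs K => (crossCount I K L q.1.1 q.1.2 : ℝ) -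
        expct I K Nc (fun L' => (crossCount I K L' q.1.1 q.1.2 : ℝ))) := by
  simp_rw [expct_cross hs]
  rw [pst_gc hs, mst_gc hs, ← Finset.sum_sub_distrib]
  unfold dotProduct
  exact Finset.sum_congr rfl fun q _ => by ring

theorem var_gc (c : Pairs K → ℝ) :
    ∑ L ∈ labelings I K Nc, (pst (ptn I) (gc c) L - mst (Fin (2 * I)) Nc (gc c)) ^ 2 =
      ((labelings I K Nc).card : ℝ) * (c ⬝ᵥ (covMatrix I K Nc).mulVec c) := by
  have hM := hs.card_pos
  simp_rw [pst_sub hs]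
  unfold dotProduct Matrix.mulVec dotProduct covMatrix covar
  simp only [Matrix.of_apply]
  set A : Pairs K → (Fin (2 * I) → Fin K) → ℝ := fun q L =>
    (crossCount I K L q.1.1 q.1.2 : ℝ) -
        expct I K Nc (fun L' => (crossCount I K L' q.1.1 q.1.2 : ℝ)) with hA
  change ∑ L ∈ labelings I K Nc, (∑ q, c q * A q L) ^ 2 =
    _ * ∑ q, c q * ∑ r, (expct I K Nc fun L => A q L * A r L) * c r
  unfold expct
  simp_rw [sq, Finset.sum_mul_sum]
  rw [Finset.sum_comm, Finset.mul_sum]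
  refine Finset.sum_congr rfl fun q _ => ?_
  rw [Finset.sum_comm, Finset.mul_sum, Finset.mul_sum]
  refine Finset.sum_congr rfl fun r _ => ?_
  have : ∑ L ∈ labelings I K Nc, c q * A q L * (c r * A r L) =
      c q * c r * ∑ L ∈ labelings I K Nc, A q L * A r L := by
    rw [Finset.mul_sum]
    exact Finset.sum_congr rfl fun L _ => by ring
  rw [this]
  field_simp

end

theorem qst_ind {K : ℕ} (Nc : Fin K → ℕ) (s : Fin K) :
    qst Nc (ind s s) = (Nc s : ℝ) * Nc s - Nc s := by
  unfold qst ind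
  have h1 : ∀ a b : Fin K, ((if a = s ∧ b = s then (1 : ℝ) else 0) +
      if b = s ∧ a = s then 1 else 0) / 2 = if a = s then (if b = s then 1 else 0) else 0 := by
    intro a b
    split_ifs <;> simp_all
  simp_rw [h1]
  simp

theorem nonempty_of_struct {I K : ℕ} (hK : 2 ≤ K) {Nc : Fin K → ℕ}
    {S : Matrix (Pairs K) (Pairs K) ℝ} (h : S * covMatrix I K Nc * S = 1) :
    (labelings I K Nc).Nonempty := by
  by_contra hne
  rw [Finset.not_nonempty_iff_eq_empty] at hne
  have h0 : covMatrix I K Nc = 0 := by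
    ext q r
    simp [covMatrix, covar, expct, hne]
  rw [h0] at h
  simp only [mul_zero, zero_mul] at h
  let q : Pairs K := ⟨(⟨0, by omega⟩, ⟨1, by omega⟩), by simp [Fin.lt_def]⟩
  have := congrFun (congrFun h q) q
  simp at this

/-- uniform law pushed forward -/
theorem exists_law {α E : Type*} [MeasurableSpace E] [MeasurableSingletonClass E]
    (Om : Finset α) (hne : Om.Nonempty) (Y : α → E) :
    ∃ P : ProbabilityMeasure E, (∀ F : E → ℝ, ∫ x, F x ∂(P : Measure E) =
      (∑ L ∈ Om, F (Y L)) / (Om.card : ℝ)) ∧ (∀ F : E → ℂ, ∫ x, F x ∂(P : Measure E) =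
      (∑ L ∈ Om, F (Y L)) / (Om.card : ℂ)) := by
  have hc : (Om.card : ENNReal) ≠ 0 := by exact_mod_cast hne.card_pos.ne'
  let P : Measure E := (Om.card : ENNReal)⁻¹ • ∑ L ∈ Om, Measure.dirac (Y L)
  have hP : IsProbabilityMeasure P := by
    constructor
    simp only [P, Measure.smul_apply, Measure.coe_finsetSum, Finset.sum_apply, measure_univ,
      Finset.sum_const, nsmul_eq_mul, mul_one, smul_eq_mul]
    exact ENNReal.inv_mul_cancel hc (ENNReal.natCast_ne_top _)
  refine ⟨⟨P, hP⟩, ?_, ?_⟩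
  · intro F
    change ∫ x, F x ∂P = _
    simp only [P]
    rw [integral_smul_measure, integral_finsetSum_measure]
    · simp [integral_dirac, div_eq_inv_mul]
    · intro i _
      exact integrable_dirac (by simp)
  · intro F
    change ∫ x, F x ∂P = _
    simp only [P]
    rw [integral_smul_measure, integral_finsetSum_measure]
    · simp [integral_dirac, div_eq_inv_mul]
    · intro i _
      exact integrable_dirac (by simp)


theorem mst_lower {I K : ℕ} {Nc : Fin K → ℕ} (hI : 1 ≤ I) {δ : ℝ} (hδ : 0 < δ) (s : Fin K)
    (h2 : 2 ≤ Nc s) (h : δ * (2 * I : ℝ) ≤ Nc s) :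
    δ ^ 2 / 2 * (2 * I : ℝ) ≤ mst (Fin (2 * I)) Nc (ind s s) := by
  unfold mst
  rw [qst_ind, Fintype.card_fin]
  push_cast
  have hI' : (1 : ℝ) ≤ I := by exact_mod_cast hI
  have h2' : (2 : ℝ) ≤ Nc s := by exact_mod_cast h2
  set N : ℝ := 2 * I with hN
  have hN2 : 2 ≤ N := by linarith
  set n : ℝ := (Nc s : ℝ)
  rw [le_div_iff₀ (by linarith)]
  have h3 : (δ * N) * (δ * N) ≤ n * n := mul_le_mul h h (by positivity) (by positivity)
  have h4 : n * n / 2 ≤ n * n - n := by nlinarith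
  have h5 : 0 ≤ δ ^ 2 * N := by positivity
  nlinarith

theorem fixed_bound {I K : ℕ} {Nc : Fin K → ℕ} (hI : 1 ≤ I)
    (hs : Setup (ptn I) Nc (labelings I K Nc)) {δ : ℝ} (hδ : 0 < δ)
    (h2 : ∀ s, 2 ≤ Nc s) (h : ∀ s, δ * (2 * I : ℝ) ≤ Nc s)
    (hbig : 64 / δ ^ 4 ≤ √(2 * I : ℝ)) (S : Matrix (Pairs K) (Pairs K) ℝ) (hS : S.PosSemidef)
    (hSS : S * covMatrix I K Nc * S = 1) (t : Pairs K → ℝ) :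
    ‖(∑ L ∈ labelings I K Nc, Complex.exp (((t ⬝ᵥ S.mulVec (fun q : Pairs K =>
        (crossCount I K L q.1.1 q.1.2 : ℝ) -
        expct I K Nc (fun L' => (crossCount I K L' q.1.1 q.1.2 : ℝ))) : ℝ) : ℂ) * Complex.I)) /
        ((labelings I K Nc).card : ℂ) - Complex.exp (-((t ⬝ᵥ t : ℝ) : ℂ) / 2)‖ ≤
      (256 * √(t ⬝ᵥ t * (4 / δ ^ 4)) ^ 3 +
        (512 * (K : ℝ) ^ 4 + 64) * √(t ⬝ᵥ t * (4 / δ ^ 4)) ^ 2) / √(2 * I : ℝ) := by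
  set c : Pairs K → ℝ := S.mulVec t with hc
  have hsym : S.transpose = S := by
    have := hS.isHermitian
    rwa [Matrix.IsHermitian, Matrix.conjTranspose_eq_transpose_of_trivial] at this
  have hdot : ∀ x, t ⬝ᵥ S.mulVec x = c ⬝ᵥ x := by
    intro x
    rw [Matrix.dotProduct_mulVec, hc]
    congr 1
    rw [← Matrix.mulVec_transpose, hsym]
  have hvar : c ⬝ᵥ (covMatrix I K Nc).mulVec c = t ⬝ᵥ t := by
    rw [← hdot, hc, Matrix.mulVec_mulVec, Matrix.mulVec_mulVec, hSS, Matrix.one_mulVec]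
  have hv := var_gc hs c
  rw [hvar] at hv
  set v := t ⬝ᵥ t with hvd
  have hv0 : 0 ≤ v := by
    rw [hvd]; unfold dotProduct
    exact Finset.sum_nonneg fun _ _ => mul_self_nonneg _
  have hI' : (1 : ℝ) ≤ I := by exact_mod_cast hI
  set γ := √(v * (4 / δ ^ 4)) with hγ
  have hγ0 : 0 ≤ γ := Real.sqrt_nonneg _
  have hγ2 : γ ^ 2 = v * (4 / δ ^ 4) := Real.sq_sqrt (by positivity)
  have hcard : (Fintype.card (Fin (2 * I)) : ℝ) = 2 * I := by rw [Fintype.card_fin]; push_cast; rfl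
  have hr0 : 0 < √(2 * I : ℝ) := Real.sqrt_pos.2 (by linarith)
  have hr2 : √(2 * I : ℝ) ^ 2 = 2 * I := Real.sq_sqrt (by linarith)
  have hlow := fun s t hst => hs.var_lower (gc c) (gc_symm c) (gc_diag c) s t hst
  have hM := hs.card_pos
  have hml := fun s => mst_lower hI hδ s (h2 s) (h s)
  simp only [hcard, hv] at hlow
  have hclt := hs.clt (gc c) (gc_symm c) (G := γ / √(2 * I : ℝ)) (v := v) (by positivity)
  rw [hcard] at hclt
  set r := √(2 * I : ℝ) with hr
  set N : ℝ := 2 * (I : ℝ) with hN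
  have hG : ∀ s t, |gc c s t| ≤ γ / r := by
    intro a b
    by_cases hab : a = b
    · rw [hab, gc_diag, abs_zero]; positivity
    apply abs_le_of_sq_le_sq _ (by positivity)
    rw [div_pow, hγ2, hr2, le_div_iff₀ (by linarith)]
    have e1 := hlow a b hab
    have e2 : δ ^ 4 / 8 * N ^ 2 ≤ mst (Fin (2 * I)) Nc (ind a a) * mst (Fin (2 * I)) Nc (ind b b)
        - 8 * N * r := by
      have e3 := mul_le_mul (hml a) (hml b) (by positivity) (hs.mu_nonneg a a)
      have e4 : 64 ≤ δ ^ 4 * r := by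
        rw [div_le_iff₀ (by positivity)] at hbig; linarith
      have e5 : 8 * N * r ≤ δ ^ 4 / 8 * N ^ 2 := by
        have : N ^ 2 = N * (r * r) := by rw [← sq r, hr2, sq]
        rw [this]
        have := mul_le_mul_of_nonneg_left e4 (by positivity : 0 ≤ N * r)
        nlinarith
      nlinarith
    have e6 : 16 * gc c a b ^ 2 * ((#(labelings I K Nc) : ℝ) * (δ ^ 4 / 8 * N ^ 2)) ≤
        8 * N * ((#(labelings I K Nc) : ℝ) * v) := by
      refine le_trans (mul_le_mul_of_nonneg_left (mul_le_mul_of_nonneg_left e2 hM.le)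
        (by positivity)) (e1.trans ?_)
      refine mul_le_mul_of_nonneg_right ?_ (by positivity)
      linarith
    have e7 : (N * (#(labelings I K Nc) : ℝ) * 2 * δ ^ 4) * (gc c a b ^ 2 * N) ≤
        (N * (#(labelings I K Nc) : ℝ) * 2 * δ ^ 4) * (v * (4 / δ ^ 4)) := by
      have : (N * (#(labelings I K Nc) : ℝ) * 2 * δ ^ 4) * (v * (4 / δ ^ 4)) =
        8 * N * ((#(labelings I K Nc) : ℝ) * v) := by
        field_simp; ring
      rw [this]
      refine le_trans (le_of_eq ?_) e6
      ring
    exact le_of_mul_le_mul_left e7 (by positivity)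
  have hfin := hclt hG hv0 hv
  have e8 : 256 * N * (γ / r) ^ 3 + (512 * (Fintype.card (Fin K) : ℝ) ^ 4 + 64) * (γ / r) ^ 2 * r =
      (256 * γ ^ 3 + (512 * (K : ℝ) ^ 4 + 64) * γ ^ 2) / r := by
    rw [Fintype.card_fin, ← hr2]
    field_simp
  rw [e8] at hfin
  refine le_trans (le_of_eq ?_) hfin
  congr 3
  refine Finset.sum_congr rfl fun L _ => ?_
  unfold ech
  rw [pst_sub hs, hdot, one_mul, mul_comm]

/-- asymptotic null normality of the standardized cross-count vector.
Here `S I = Σ_N^{-1/2}` is characterized as the unique positive semidefinite matrix with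
`S Σ_N S = Id` (the covariance `Σ_N` being positive definite since all class sizes are
even), convergence in distribution is phrased via bounded continuous test functions, and
the standard `m`-dimensional Gaussian (mean `0`, identity covariance) is the product of
`m` standard normals. -/
theorem stmt10 (K : ℕ) (hK : 2 ≤ K)
    (Nc : ℕ → Fin K → ℕ) (p : Fin K → ℝ)
    (hp : ∀ s, p s ∈ Set.Ioo (0 : ℝ) 1) (hps : ∑ s, p s = 1)
    (hlim : ∀ s, Tendsto (fun I : ℕ => (Nc I s : ℝ) / (2 * I : ℝ)) atTop (𝓝 (p s)))
    (S : (I : ℕ) → Matrix (Pairs K) (Pairs K) ℝ)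
    (hstruct : ∀ᶠ I : ℕ in atTop,
        (∀ s, 0 < Nc I s) ∧ (∀ s, Even (Nc I s)) ∧ (∑ s, Nc I s = 2 * I)
        ∧ (S I).PosSemidef ∧ S I * covMatrix I K (Nc I) * S I = 1) :
    ∀ f : BoundedContinuousFunction (Pairs K → ℝ) ℝ,
      Tendsto (fun I : ℕ => expct I K (Nc I) (fun L =>
          f ((S I).mulVec (fun q : Pairs K =>
            (crossCount I K L q.1.1 q.1.2 : ℝ)
              - expct I K (Nc I) (fun L' => (crossCount I K L' q.1.1 q.1.2 : ℝ))))))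
        atTop
        (𝓝 (∫ x, f x ∂(Measure.pi fun _ : Pairs K => gaussianReal 0 1))) := by
  classical
  -- a uniform lower bound for the proportions
  have : Nonempty (Fin K) := ⟨⟨0, by omega⟩⟩
  obtain ⟨s0, hs0⟩ := Finite.exists_min p
  set δ : ℝ := p s0 / 2 with hδd
  have hδ : 0 < δ := by have := (hp s0).1; positivity
  have hprop : ∀ᶠ I : ℕ in atTop, ∀ s, δ < (Nc I s : ℝ) / (2 * I : ℝ) := by
    rw [eventually_all]
    intro s
    refine (hlim s).eventually (lt_mem_nhds ?_)
    have := hs0 s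
    have := (hp s0).1
    linarith
  have hsqrt : Tendsto (fun I : ℕ => √(2 * I : ℝ)) atTop atTop :=
    Real.tendsto_sqrt_atTop.comp
      (tendsto_natCast_atTop_atTop.const_mul_atTop (by norm_num : (0 : ℝ) < 2))
  -- the laws
  let Y : (I : ℕ) → (Fin (2 * I) → Fin K) → EuclideanSpace ℝ (Pairs K) := fun I L =>
    WithLp.toLp 2 ((S I).mulVec (fun q : Pairs K =>
            (crossCount I K L q.1.1 q.1.2 : ℝ)
              - expct I K (Nc I) (fun L' => (crossCount I K L' q.1.1 q.1.2 : ℝ))))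
  let γm : Measure (EuclideanSpace ℝ (Pairs K)) :=
    (Measure.pi fun _ : Pairs K => gaussianReal 0 1).map (WithLp.toLp 2)
  have hγm : IsProbabilityMeasure γm :=
    Measure.isProbabilityMeasure_map (by fun_prop)
  let γp : ProbabilityMeasure (EuclideanSpace ℝ (Pairs K)) := ⟨γm, hγm⟩
  let P : ℕ → ProbabilityMeasure (EuclideanSpace ℝ (Pairs K)) := fun I =>
    if h : (labelings I K (Nc I)).Nonempty then
      (exists_law (labelings I K (Nc I)) h (Y I)).choose else γp
  have hP : ∀ I, (labelings I K (Nc I)).Nonempty →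
      (∀ F : EuclideanSpace ℝ (Pairs K) → ℝ, ∫ x, F x ∂(P I : Measure _) =
        (∑ L ∈ labelings I K (Nc I), F (Y I L)) / ((labelings I K (Nc I)).card : ℝ)) ∧
      (∀ F : EuclideanSpace ℝ (Pairs K) → ℂ, ∫ x, F x ∂(P I : Measure _) =
        (∑ L ∈ labelings I K (Nc I), F (Y I L)) / ((labelings I K (Nc I)).card : ℂ)) := by
    intro I h
    have := (exists_law (labelings I K (Nc I)) h (Y I)).choose_spec
    simpa only [P, dif_pos h] using this
  have hne : ∀ᶠ I : ℕ in atTop, (labelings I K (Nc I)).Nonempty := by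
    filter_upwards [hstruct] with I hI
    exact nonempty_of_struct hK hI.2.2.2.2
  have hgauss : ∀ t : EuclideanSpace ℝ (Pairs K),
      charFun γm t = Complex.exp (-((WithLp.ofLp t ⬝ᵥ WithLp.ofLp t : ℝ) : ℂ) / 2) := by
    intro t
    simp only [γm]
    rw [charFun_pi]
    simp_rw [charFun_gaussianReal]
    rw [← Complex.exp_sum]
    congr 1
    unfold dotProduct
    push_cast
    rw [← Finset.sum_neg_distrib, Finset.sum_div]
    refine Finset.sum_congr rfl fun q _ => ?_
    simp
    ring
  have hconv : Tendsto P atTop (𝓝 γp) := by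
    refine ProbabilityMeasure.tendsto_of_tendsto_charFun fun t => ?_
    change Tendsto (fun n => charFun (P n : Measure _) t) atTop (𝓝 (charFun γm t))
    rw [hgauss, tendsto_iff_norm_sub_tendsto_zero]
    set v := WithLp.ofLp t ⬝ᵥ WithLp.ofLp t
    refine squeeze_zero' (Eventually.of_forall fun _ => norm_nonneg _) ?_
      ((tendsto_const_nhds (x := (256 * √(v * (4 / δ ^ 4)) ^ 3 +
        (512 * (K : ℝ) ^ 4 + 64) * √(v * (4 / δ ^ 4)) ^ 2))).div_atTop hsqrt)
    filter_upwards [hstruct, hne, hprop, eventually_ge_atTop 1,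
      hsqrt.eventually_ge_atTop (64 / δ ^ 4)] with I h1 h2 h3 h4 h5
    have h6 : (0 : ℝ) < 2 * I := by
      have : (1 : ℝ) ≤ I := by exact_mod_cast h4
      linarith
    have h7 := fixed_bound h4 (setup I K (Nc I) h4 h2) hδ
      (fun s => by
        obtain ⟨k, hk⟩ := h1.2.1 s
        have := h1.1 s
        omega)
      (fun s => ((lt_div_iff₀ h6).1 (h3 s)).le) h5 (S I) h1.2.2.2.1 h1.2.2.2.2 (WithLp.ofLp t)
    refine le_trans (le_of_eq ?_) h7
    rw [charFun_apply, (hP I h2).2]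
    congr 3
  intro f
  rw [ProbabilityMeasure.tendsto_iff_forall_integral_tendsto] at hconv
  let f' : BoundedContinuousFunction (EuclideanSpace ℝ (Pairs K)) ℝ :=
    f.compContinuous ⟨WithLp.ofLp, PiLp.continuous_ofLp 2 _⟩
  have h1 := hconv f'
  have h2 : ∫ x, f' x ∂(γp : Measure _) =
      ∫ x, f x ∂(Measure.pi fun _ : Pairs K => gaussianReal 0 1) := by
    change ∫ x, f' x ∂γm = _
    simp only [γm]
    rw [integral_map (by fun_prop) f'.continuous.aestronglyMeasurable]
    rfl
  rw [h2] at h1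
  refine h1.congr' ?_
  filter_upwards [hne] with I hI
  rw [(hP I hI).1]
  rfl

end Crossmatch
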